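/- Let G = (V, E) be a finite DAG and Y ∈ V a node with at least one parent. Then the LSCA closure L∞(Pa(Y)) of the parents of Y is the minimal globally interventionally superior set of G relative to Y: it is a GISS relative to Y, and every GISS of G relative to Y that is minimal with respect to set inclusion equals L∞(Pa(Y)). -/

import Mathlib

open scoped Classical

/-! ## Directed graphs, paths, ancestors -/

/-- A directed graph (given by its edge relation) is acyclic if no node is
reachable from itself by a non-trivial directed walk. -/
def Acyclic {V : Type} (E : V → V → Prop) : Prop :=
  ∀ v : V, ¬ Relation.TransGen E v v

/-- `IsPath E a b p` : the list `p` is a directed path from `a` to `b` in the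
graph with edge relation `E` (a path is a nonempty list of nodes in which each
node has an edge to the next; a single-node path is trivial). -/
def IsPath {V : Type} (E : V → V → Prop) (a b : V) (p : List V) : Prop :=
  p.Chain' E ∧ p.head? = some a ∧ p.getLast? = some b

/-- Descendants of `v` (every node is a descendant of itself). -/
def De {V : Type} (E : V → V → Prop) (v : V) : Set V :=
  {u | Relation.ReflTransGen E v u}

/-- Ancestors of `v` (every node is an ancestor of itself). -/
def An {V : Type} (E : V → V → Prop) (v : V) : Set V :=
  {u | Relation.ReflTransGen E u v}

/-- Parents of `v`. -/
def Pa {V : Type} (E : V → V → Prop) (v : V) : Set V :=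
  {p | E p v}

/-! ## Strict common ancestors, LSCAs, and the LSCA closure -/

/-- `v` is a strict common ancestor of `x` and `y` : there is a path from `v`
to `x` not containing `y`, and a path from `v` to `y` not containing `x`. -/
def SCA {V : Type} (E : V → V → Prop) (x y : V) : Set V :=
  {v | (∃ p, IsPath E v x p ∧ y ∉ p) ∧ (∃ p, IsPath E v y p ∧ x ∉ p)}

/-- `v` is a lowest strict common ancestor of `x` and `y` : it is a strict
common ancestor, and no strict common ancestor of `x,y` other than `v` is a
descendant of `v`. -/
def LSCApair {V : Type} (E : V → V → Prop) (x y : V) : Set V :=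
  {v | v ∈ SCA E x y ∧ ∀ w ∈ SCA E x y, w ≠ v → w ∉ De E v}

/-- The lowest strict common ancestors of a set `U` : nodes outside `U` that
are a lowest strict common ancestor of some pair of nodes of `U`. -/
def LSCAset {V : Type} (E : V → V → Prop) (U : Set V) : Set V :=
  {v | v ∉ U ∧ ∃ u ∈ U, ∃ u' ∈ U, v ∈ LSCApair E u u'}

/-- The `i`-th order LSCA set of `U`. -/
def lscaIter {V : Type} (E : V → V → Prop) (U : Set V) : ℕ → Set V
  | 0 => U
  | k + 1 => LSCAset E (lscaIter E U k) ∪ lscaIter E U k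

/-- The LSCA closure `L∞(U)` of `U`.  (The sets `lscaIter E U i` are increasing
in `i`, so on a finite node type this union equals `lscaIter E U k` for the
least `k` with `lscaIter E U k = lscaIter E U (k+1)`.) -/
def lscaClosure {V : Type} (E : V → V → Prop) (U : Set V) : Set V :=
  ⋃ k : ℕ, lscaIter E U k

/-! ## Λ-structures -/

/-- `(v, pa, pb)` is a Λ-structure over `(a, b)` : `pa` is a path from `v` to
`a`, `pb` is a path from `v` to `b`, and the two paths intersect only at `v`
(trivial paths are allowed). -/
def IsLambdaStruct {V : Type} (E : V → V → Prop) (v a b : V) (pa pb : List V) : Prop :=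
  IsPath E v a pa ∧ IsPath E v b pb ∧ ∀ w ∈ pa, w ∈ pb → w = v

/-- `Λ(U, W)` : the set of nodes forming a Λ-structure over `(U, W)`. -/
def LambdaSet {V : Type} (E : V → V → Prop) (U W : Set V) : Set V :=
  {v | ∃ u ∈ U, ∃ w ∈ W, ∃ pa pb : List V, IsLambdaStruct E v u w pa pb}

/-! ## Structural causal models -/

/-- A structural causal model over the graph with node type `V` and edge
relation `E` : each node `v` has a nonempty finite range `R v`, a nonempty
finite noise range `N v`, and a structural assignment `f v` computing the value
of `v` from the values of its parents and its noise value. -/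
structure SCM (V : Type) (E : V → V → Prop) where
  R : V → Type
  rFin : ∀ v, Finite (R v)
  rNe : ∀ v, Nonempty (R v)
  N : V → Type
  nFin : ∀ v, Finite (N v)
  nNe : ∀ v, Nonempty (N v)
  f : ∀ v : V, (∀ p : {p // E p v}, R p.1) → N v → R v

/-- Fuel-bounded approximation to the unrolled assignment. -/
noncomputable def approx {V : Type} {E : V → V → Prop} (scm : SCM V E)
    (n : ∀ v, scm.N v) : ℕ → ∀ v, scm.R v
  | 0 => fun v => (scm.rNe v).some
  | k + 1 => fun v => scm.f v (fun p => approx scm n k p.1) (n v)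

/-- The unrolled assignment `f̄_v(n)` of an SCM over an acyclic graph: the value
of `v` obtained by recursively composing the structural assignments of the
ancestors of `v`, evaluated at the unit `n`.  (On an acyclic graph every
directed path has fewer than `card V + 1` nodes, so this fuel value computes
the exact fixed point of the unrolling recursion
`f̄_v(n) = f_v((f̄_p(n))_{p ∈ Pa(v)}, n_v)`.) -/
noncomputable def unroll {V : Type} [Fintype V] {E : V → V → Prop} (scm : SCM V E)
    (n : ∀ v, scm.N v) (v : V) : scm.R v :=
  approx scm n (Fintype.card V + 1) v

/-- The atomic intervention `do(X = x)` : replace the structural assignment of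
`X` by the constant function with value `x`. -/
noncomputable def SCM.intervene {V : Type} {E : V → V → Prop} (scm : SCM V E)
    (X : V) (x : scm.R X) : SCM V E where
  R := scm.R
  rFin := scm.rFin
  rNe := scm.rNe
  N := scm.N
  nFin := scm.nFin
  nNe := scm.nNe
  f := fun v => if h : v = X then fun _ _ => h.symm ▸ x else scm.f v

/-- Fuel-bounded approximation to the blocked unrolled assignment. -/
noncomputable def blockApprox {V : Type} [Fintype V] {E : V → V → Prop} (scm : SCM V E)
    (B : V) (b : scm.R B) (n : ∀ v, scm.N v) : ℕ → ∀ v, scm.R v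
  | 0 => fun v =>
      if h : v = B then h.symm ▸ b
      else if Relation.ReflTransGen E B v then (scm.rNe v).some
      else unroll scm n v
  | k + 1 => fun v =>
      if h : v = B then h.symm ▸ b
      else if Relation.ReflTransGen E B v then
        scm.f v (fun p => blockApprox scm B b n k p.1) (n v)
      else unroll scm n v

/-- The blocked unrolled assignment `f̄_v[B](b, n)` : equal to `b` at `v = B`,
to the plain unrolled assignment `f̄_v(n)` if `v` is not a descendant of `B`,
and otherwise obtained by the unrolling recursion
`f̄_v[B](b,n) = f_v((f̄_p[B](b,n))_{p ∈ Pa(v)}, n_v)`. -/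
noncomputable def blockUnroll {V : Type} [Fintype V] {E : V → V → Prop} (scm : SCM V E)
    (B : V) (b : scm.R B) (n : ∀ v, scm.N v) (v : V) : scm.R v :=
  blockApprox scm B b n (Fintype.card V + 1) v

/-- The edge relation of the graph obtained after a conditional intervention on
`X` with conditioning set `A` : the parent set of `X` becomes `A`, and all
other edges are unchanged. -/
def condE {V : Type} (E : V → V → Prop) (X : V) (A : Set V) : V → V → Prop :=
  fun a b => (b = X ∧ a ∈ A) ∨ (b ≠ X ∧ E a b)

/-- The conditional intervention `do(X = g(A))` : replace the structural
assignment of `X` by the function that, given the values of the nodes in `A`,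
outputs `g` of those values, so that `A` becomes the parent set of `X`. -/
noncomputable def SCM.condIntervene {V : Type} {E : V → V → Prop} (scm : SCM V E)
    (X : V) (A : Set V) (g : (∀ a : A, scm.R a.1) → scm.R X) :
    SCM V (condE E X A) where
  R := scm.R
  rFin := scm.rFin
  rNe := scm.rNe
  N := scm.N
  nFin := scm.nFin
  nNe := scm.nNe
  f := fun v par nv =>
    if h : v = X then h.symm ▸ g (fun a => par ⟨a.1, Or.inl ⟨h, a.2⟩⟩)
    else scm.f v (fun p => par ⟨p.1, Or.inr ⟨h, p.2⟩⟩) nv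

/-! ## Interventional superiority -/

/-- `X` is (deterministically atomic-interventionally) superior to `W` relative
to `Y` : for every SCM over the graph in which the range of `Y` is linearly
ordered, and every unit `n`, there is `x ∈ R_X` such that for all `w ∈ R_W`,
`f̄_Y^{do(X=x)}(n) ≥ f̄_Y^{do(W=w)}(n)`. -/
def Superior {V : Type} [Fintype V] (E : V → V → Prop) (Y X W : V) : Prop :=
  ∀ (scm : SCM V E) (L : LinearOrder (scm.R Y)) (n : ∀ v, scm.N v),
    ∃ x : scm.R X, ∀ w : scm.R W,
      L.le (unroll (scm.intervene W w) n Y) (unroll (scm.intervene X x) n Y)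

/-- Superiority for sets of nodes: `S ≽_Y T` iff every node of `T` is inferior
to some node of `S`. -/
def SetSuperior {V : Type} [Fintype V] (E : V → V → Prop) (Y : V) (S T : Set V) : Prop :=
  ∀ W ∈ T, ∃ X ∈ S, Superior E Y X W

/-- A globally interventionally superior set (GISS) of the graph relative to
`Y` : a subset `U` of `V \ {Y}` with `U ≽_Y (V \ {Y}) \ U`. -/
def IsGISS {V : Type} [Fintype V] (E : V → V → Prop) (Y : V) (U : Set V) : Prop :=
  U ⊆ Set.univ \ {Y} ∧ SetSuperior E Y U ((Set.univ \ {Y}) \ U)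

/-- A minimal globally interventionally superior set (mGISS): a GISS that is
minimal with respect to set inclusion. -/
def IsMGISS {V : Type} [Fintype V] (E : V → V → Prop) (Y : V) (U : Set V) : Prop :=
  IsGISS E Y U ∧ ∀ U' : Set V, IsGISS E Y U' → U' ⊆ U → U' = U

/-! ## Reachability avoiding a node -/

/-- `AvoidReach E z a b`: some directed walk from `a` to `b` does not visit `z`, except possibly at
its starting node. -/
def AvoidReach {V : Type} (E : V → V → Prop) (z : V) : V → V → Prop :=
  Relation.ReflTransGen (fun a b => E a b ∧ b ≠ z)

lemma AvoidReach.reach {V : Type} {E : V → V → Prop} {z a b : V} (h : AvoidReach E z a b) :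
    Relation.ReflTransGen E a b :=
  Relation.ReflTransGen.mono (fun _ _ h => h.1) _ _ h

lemma AvoidReach.ne {V : Type} {E : V → V → Prop} {z a b : V} (h : AvoidReach E z a b)
    (ha : a ≠ z) : b ≠ z := by
  induction h with
  | refl => exact ha
  | tail _ h _ => exact h.2

lemma avoidReach_of_isPath {V : Type} {E : V → V → Prop} {z b : V} (p : List V) :
    ∀ a, IsPath E a b p → z ∉ p → a ≠ z ∧ AvoidReach E z a b := by
  induction p with
  | nil => rintro a ⟨-, h, -⟩; simp at h
  | cons x l ih =>
    rintro a ⟨hc, hh, hl⟩ hz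
    obtain rfl : x = a := by simpa using hh
    rw [List.mem_cons, not_or] at hz
    refine ⟨Ne.symm hz.1, ?_⟩
    cases l with
    | nil =>
      obtain rfl : x = b := by simpa using hl
      exact Relation.ReflTransGen.refl
    | cons y l =>
      have hc' := List.isChain_cons_cons.1 hc
      obtain ⟨hy, hr⟩ := ih y ⟨hc'.2, rfl, by simpa using hl⟩ hz.2
      exact Relation.ReflTransGen.head ⟨hc'.1, hy⟩ hr

lemma exists_isPath_of_avoidReach {V : Type} {E : V → V → Prop} {z a b : V}
    (h : AvoidReach E z a b) (ha : a ≠ z) : ∃ p, IsPath E a b p ∧ z ∉ p := by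
  induction h using Relation.ReflTransGen.head_induction_on with
  | refl => exact ⟨[b], ⟨List.isChain_singleton b, rfl, rfl⟩, by simpa using ha.symm⟩
  | @head u c hac _ ih =>
    obtain ⟨p, ⟨hc, hh, hl⟩, hz⟩ := ih hac.2
    cases p with
    | nil => simp at hh
    | cons x l =>
      obtain rfl : x = c := by simpa using hh
      refine ⟨u :: x :: l, ⟨List.isChain_cons_cons.2 ⟨hac.1, hc⟩, rfl, by simpa using hl⟩, ?_⟩
      rw [List.mem_cons, not_or]
      exact ⟨ha.symm, hz⟩

lemma mem_SCA_iff {V : Type} {E : V → V → Prop} {x y v : V} :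
    v ∈ SCA E x y ↔ (v ≠ y ∧ AvoidReach E y v x) ∧ (v ≠ x ∧ AvoidReach E x v y) := by
  constructor
  · rintro ⟨⟨p, hp, hp'⟩, ⟨q, hq, hq'⟩⟩
    exact ⟨avoidReach_of_isPath p v hp hp', avoidReach_of_isPath q v hq hq'⟩
  · rintro ⟨⟨h1, h2⟩, ⟨h3, h4⟩⟩
    exact ⟨exists_isPath_of_avoidReach h2 h1, exists_isPath_of_avoidReach h4 h3⟩

lemma reflTransGen_avoid_or_through {V : Type} {r : V → V → Prop} {a b : V} (z : V)
    (h : Relation.ReflTransGen r a b) :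
    Relation.ReflTransGen (fun a b => r a b ∧ b ≠ z) a b ∨
      (Relation.ReflTransGen r a z ∧ Relation.ReflTransGen r z b) := by
  induction h with
  | refl => exact Or.inl .refl
  | tail hab hbc ih =>
    rename_i b c
    rcases ih with ih | ⟨h1, h2⟩
    · by_cases hc : c = z
      · subst hc
        exact Or.inr ⟨hab.tail hbc, .refl⟩
      · exact Or.inl (ih.tail ⟨hbc, hc⟩)
    · exact Or.inr ⟨h1, h2.tail hbc⟩

/-! ## Acyclicity -/

lemma Acyclic.antisymm {V : Type} {E : V → V → Prop} (hacy : Acyclic E) {a b : V}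
    (hab : Relation.ReflTransGen E a b) (hba : Relation.ReflTransGen E b a) : a = b := by
  rcases Relation.reflTransGen_iff_eq_or_transGen.1 hab with h | h
  · exact h.symm
  · exact absurd (h.trans_left hba) (hacy a)

lemma Acyclic.wellFounded_transGen {V : Type} [Finite V] {E : V → V → Prop} (hacy : Acyclic E) :
    WellFounded (Relation.TransGen E) :=
  have : Std.Irrefl (Relation.TransGen E) := ⟨hacy⟩
  Finite.wellFounded_of_trans_of_irrefl _

lemma Acyclic.wellFounded_transGen_swap {V : Type} [Finite V] {E : V → V → Prop}
    (hacy : Acyclic E) : WellFounded (Function.swap (Relation.TransGen E)) :=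
  have : Std.Irrefl (Function.swap (Relation.TransGen E)) := ⟨hacy⟩
  have : IsTrans V (Function.swap (Relation.TransGen E)) := ⟨fun _ _ _ h1 h2 => h2.trans h1⟩
  Finite.wellFounded_of_trans_of_irrefl _

lemma ncard_An_lt {V : Type} [Finite V] {E : V → V → Prop} (hacy : Acyclic E) {p v : V}
    (h : E p v) : (An E p).ncard < (An E v).ncard := by
  refine Set.ncard_lt_ncard ⟨fun u hu => Relation.ReflTransGen.tail hu h, fun hs => ?_⟩
    (Set.toFinite _)
  have hv : Relation.ReflTransGen E v p := hs Relation.ReflTransGen.refl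
  exact hacy v (Relation.TransGen.tail' hv h)

/-! ## Unrolled assignments -/

lemma approx_succ_eq {V : Type} [Finite V] {E : V → V → Prop} (hacy : Acyclic E)
    (scm : SCM V E) (n : ∀ v, scm.N v) (k : ℕ) :
    ∀ v, (An E v).ncard ≤ k → approx scm n (k + 1) v = approx scm n k v := by
  induction k with
  | zero =>
    intro v hv
    have hpos : 0 < (An E v).ncard :=
      (Set.ncard_pos (Set.toFinite _)).2 ⟨v, Relation.ReflTransGen.refl⟩
    omega
  | succ k ih =>
    intro v hv
    change scm.f v (fun p => approx scm n (k + 1) p.1) (n v) =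
      scm.f v (fun p => approx scm n k p.1) (n v)
    congr 1
    funext p
    have := ncard_An_lt hacy p.2
    exact ih p.1 (by omega)

lemma unroll_eq {V : Type} [Fintype V] {E : V → V → Prop} (hacy : Acyclic E)
    (scm : SCM V E) (n : ∀ v, scm.N v) (v : V) :
    unroll scm n v = scm.f v (fun p => unroll scm n p.1) (n v) := by
  have hle : (An E v).ncard ≤ Fintype.card V := by
    rw [← Nat.card_eq_fintype_card]
    exact Set.ncard_le_card _
  exact (approx_succ_eq hacy scm n (Fintype.card V + 1) v (by omega)).symm

lemma unroll_intervene_self {V : Type} [Fintype V] {E : V → V → Prop} (scm : SCM V E)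
    (n : ∀ v, scm.N v) (X : V) (x : scm.R X) : unroll (scm.intervene X x) n X = x := by
  change (scm.intervene X x).f X _ _ = x
  simp [SCM.intervene]

lemma unroll_intervene_of_ne {V : Type} [Fintype V] {E : V → V → Prop} (hacy : Acyclic E)
    (scm : SCM V E) (n : ∀ v, scm.N v) (X : V) (x : scm.R X) {v : V} (hv : v ≠ X) :
    unroll (scm.intervene X x) n v =
      scm.f v (fun p => unroll (scm.intervene X x) n p.1) (n v) := by
  refine (unroll_eq hacy (scm.intervene X x) n v).trans ?_
  simp [SCM.intervene, hv]

/-! ## Superiority is domination -/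

lemma unroll_intervene_eq_of_not_avoidReach {V : Type} [Fintype V] {E : V → V → Prop}
    (hacy : Acyclic E) (scm : SCM V E) (n : ∀ v, scm.N v) (X W : V) (w : scm.R W) (v : V)
    (hv : ¬ AvoidReach E X W v) :
    unroll (scm.intervene X (unroll (scm.intervene W w) n X)) n v =
      unroll (scm.intervene W w) n v := by
  induction v using hacy.wellFounded_transGen.induction with
  | _ v ih =>
    by_cases hvX : v = X
    · subst hvX
      exact unroll_intervene_self scm n v _
    · have hvW : v ≠ W := by
        rintro rfl
        exact hv .refl
      refine (unroll_intervene_of_ne hacy scm n X _ hvX).trans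
        (Eq.trans ?_ (unroll_intervene_of_ne hacy scm n W w hvW).symm)
      congr 1
      funext p
      exact ih p.1 (.single p.2) fun h => hv (h.tail ⟨p.2, hvX⟩)

lemma superior_of_not_avoidReach {V : Type} [Fintype V] {E : V → V → Prop} (hacy : Acyclic E)
    {Y X W : V} (h : ¬ AvoidReach E X W Y) : Superior E Y X W := by
  intro scm L n
  have := scm.rFin W
  have := scm.rNe W
  obtain ⟨w, hw⟩ := Finite.exists_max fun w : scm.R W =>
    (unroll (scm.intervene W w) n Y : scm.R Y)
  refine ⟨unroll (scm.intervene W w) n X, fun w' => ?_⟩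
  rw [unroll_intervene_eq_of_not_avoidReach hacy scm n X W w Y h]
  exact hw w'

/-- The Boolean model in which every node is the disjunction of its parents other than `Z`. -/
noncomputable def orSCM {V : Type} (E : V → V → Prop) (Z : V) : SCM V E where
  R := fun _ => Prop
  rFin := fun _ => inferInstance
  rNe := fun _ => inferInstance
  N := fun _ => Unit
  nFin := fun _ => inferInstance
  nNe := fun _ => inferInstance
  f := fun _ par _ => ∃ p, p.1 ≠ Z ∧ par p

lemma orSCM_of_avoidReach {V : Type} [Fintype V] {E : V → V → Prop} (hacy : Acyclic E)
    {Z W v : V} (hW : W ≠ Z) (h : AvoidReach E Z W v) :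
    unroll ((orSCM E Z).intervene W True) (fun _ => ()) v := by
  induction h with
  | refl =>
    exact of_eq_true (unroll_intervene_self (orSCM E Z) (fun _ => ()) W True)
  | tail hab hbc ih =>
    rename_i b c
    have hcW : c ≠ W := by
      rintro rfl
      exact hacy c (Relation.TransGen.tail' (AvoidReach.reach hab) hbc.1)
    rw [unroll_intervene_of_ne hacy (orSCM E Z) (fun _ => ()) W True hcW]
    exact ⟨⟨b, hbc.1⟩, AvoidReach.ne hab hW, ih⟩

lemma not_orSCM_intervene {V : Type} [Fintype V] {E : V → V → Prop} (hacy : Acyclic E)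
    {Z : V} (z : Prop) (v : V) (hv : v ≠ Z) :
    ¬ (unroll ((orSCM E Z).intervene Z z) (fun _ => ()) v : Prop) := by
  induction v using hacy.wellFounded_transGen.induction with
  | _ v ih =>
    rw [unroll_intervene_of_ne hacy (orSCM E Z) (fun _ => ()) Z z hv]
    rintro ⟨p, hp, h⟩
    exact ih p.1 (.single p.2) hp h

lemma not_superior_of_avoidReach {V : Type} [Fintype V] {E : V → V → Prop} (hacy : Acyclic E)
    {Y X W : V} (hW : W ≠ X) (h : AvoidReach E X W Y) : ¬ Superior E Y X W := by
  intro hs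
  obtain ⟨x, hx⟩ := hs (orSCM E X) (inferInstance : LinearOrder Prop) fun _ => ()
  exact not_orSCM_intervene hacy x Y (h.ne hW) (hx True (orSCM_of_avoidReach hacy hW h))

/-! ## The LSCA closure -/

lemma lscaIter_mono {V : Type} (E : V → V → Prop) (U : Set V) : Monotone (lscaIter E U) :=
  monotone_nat_of_le_succ fun _ => Set.subset_union_right

lemma subset_lscaClosure {V : Type} (E : V → V → Prop) (U : Set V) : U ⊆ lscaClosure E U :=
  Set.subset_iUnion (lscaIter E U) 0

lemma mem_lscaClosure_of_mem_LSCApair {V : Type} {E : V → V → Prop} {U : Set V} {u u' v : V}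
    (hu : u ∈ lscaClosure E U) (hu' : u' ∈ lscaClosure E U) (hv : v ∈ LSCApair E u u') :
    v ∈ lscaClosure E U := by
  obtain ⟨i, hi⟩ := Set.mem_iUnion.1 hu
  obtain ⟨j, hj⟩ := Set.mem_iUnion.1 hu'
  by_contra hvU
  exact hvU <| Set.mem_iUnion.2 ⟨max i j + 1, Or.inl
    ⟨fun h => hvU (Set.mem_iUnion.2 ⟨_, h⟩),
      u, lscaIter_mono E U (le_max_left i j) hi, u', lscaIter_mono E U (le_max_right i j) hj, hv⟩⟩

lemma avoidReach_of_mem_lscaIter {V : Type} {E : V → V → Prop} {Y : V} (k : ℕ) :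
    ∀ v ∈ lscaIter E (Pa E Y) k, ∀ z, z ≠ v → z ≠ Y → AvoidReach E z v Y := by
  induction k with
  | zero => exact fun v hv z _ hzY => .single ⟨hv, hzY.symm⟩
  | succ k ih =>
    rintro v (⟨-, u, hu, u', hu', hv, hlow⟩ | hv) z hzv hzY
    · obtain ⟨⟨hvu', h⟩, hvu, h'⟩ := mem_SCA_iff.1 hv
      by_cases hzu : z = u
      · subst hzu
        exact h'.trans (ih u' hu' z (h'.ne hvu).symm hzY)
      by_cases hzu' : z = u'
      · subst hzu'
        exact h.trans (ih u hu z (h.ne hvu').symm hzY)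
      rcases reflTransGen_avoid_or_through z h with h | ⟨hvz, hzu1⟩
      · exact (Relation.ReflTransGen.mono (fun _ _ h => ⟨h.1.1, h.2⟩) _ _ h).trans (ih u hu z hzu hzY)
      rcases reflTransGen_avoid_or_through z h' with h' | ⟨-, hzu2⟩
      · exact (Relation.ReflTransGen.mono (fun _ _ h => ⟨h.1.1, h.2⟩) _ _ h').trans
          (ih u' hu' z hzu' hzY)
      exact absurd (AvoidReach.reach hvz)
        (hlow z (mem_SCA_iff.2 ⟨⟨hzu', hzu1⟩, hzu, hzu2⟩) hzv)
    · exact ih v hv z hzv hzY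

lemma transGen_of_mem_lscaIter {V : Type} {E : V → V → Prop} {Y : V} (k : ℕ) :
    ∀ v ∈ lscaIter E (Pa E Y) k, Relation.TransGen E v Y := by
  induction k with
  | zero => exact fun v hv => .single hv
  | succ k ih =>
    rintro v (⟨-, u, hu, u', -, hv, -⟩ | hv)
    · exact Relation.TransGen.trans_right (mem_SCA_iff.1 hv).1.2.reach (ih u hu)
    · exact ih v hv

/-- `FirstHit E C v x`: some directed walk from `v` meets `C` for the first time at `x`. -/
inductive FirstHit {V : Type} (E : V → V → Prop) (C : Set V) : V → V → Prop
  | here {v : V} : v ∈ C → FirstHit E C v v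
  | step {v c x : V} : v ∉ C → E v c → FirstHit E C c x → FirstHit E C v x

namespace FirstHit

variable {V : Type} {E : V → V → Prop} {C : Set V}

lemma mem {v x : V} (h : FirstHit E C v x) : x ∈ C := by
  induction h with
  | here h => exact h
  | step _ _ _ ih => exact ih

lemma avoidReach {v x z : V} (h : FirstHit E C v x) (hz : z ∈ C) (hzx : z ≠ x) :
    v ≠ z ∧ AvoidReach E z v x := by
  induction h with
  | here _ => exact ⟨hzx.symm, .refl⟩
  | step hv hvc _ ih =>
    obtain ⟨h1, h2⟩ := ih hzx
    exact ⟨fun h => hv (h ▸ hz), .head ⟨hvc, h1⟩ h2⟩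

lemma exists_ne_of_avoidReach {Y z v : V} (hP : Pa E Y ⊆ C) (h : AvoidReach E z v Y)
    (hvY : v ≠ Y) (hvz : v ≠ z) : ∃ x, x ≠ z ∧ FirstHit E C v x := by
  induction h using Relation.ReflTransGen.head_induction_on with
  | refl => exact absurd rfl hvY
  | @head v c hvc _ ih =>
    by_cases hvC : v ∈ C
    · exact ⟨v, hvz, .here hvC⟩
    · obtain ⟨x, hx, h⟩ := ih (fun h => hvC (hP (h ▸ hvc.1))) hvc.2
      exact ⟨x, hx, .step hvC hvc.1 h⟩

/-- If the first hits from `v` in `C` are unique, then they lie on every walk into `C`. -/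
lemma notMem_of_avoidReach {v x y : V} (hv : ∀ x', FirstHit E C v x' → x' = x)
    (h : AvoidReach E x v y) (hvx : v ≠ x) : y ∉ C := by
  intro hy
  suffices ∃ x', x' ≠ x ∧ FirstHit E C v x' by
    obtain ⟨x', hx', h'⟩ := this
    exact hx' (hv x' h')
  clear hv
  induction h using Relation.ReflTransGen.head_induction_on with
  | refl => exact ⟨y, hvx, .here hy⟩
  | @head v c hvc _ ih =>
    by_cases hvC : v ∈ C
    · exact ⟨v, hvx, .here hvC⟩
    · obtain ⟨x', hx', h⟩ := ih hvc.2
      exact ⟨x', hx', .step hvC hvc.1 h⟩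

lemma exists_of_reach {v y : V} (h : Relation.ReflTransGen E v y) (hy : y ∈ C) :
    ∃ x, FirstHit E C v x := by
  induction h using Relation.ReflTransGen.head_induction_on with
  | refl => exact ⟨y, .here hy⟩
  | @head v c hvc _ ih =>
    by_cases hvC : v ∈ C
    · exact ⟨v, .here hvC⟩
    · obtain ⟨x, h⟩ := ih
      exact ⟨x, .step hvC hvc h⟩

/-- If `C` is closed under lowest strict common ancestors, then first hits are unique. -/
lemma unique [Finite V] (hacy : Acyclic E)
    (hC : ∀ u ∈ C, ∀ u' ∈ C, LSCApair E u u' ⊆ C) (v : V) :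
    ∀ x x', FirstHit E C v x → FirstHit E C v x' → x = x' := by
  induction v using hacy.wellFounded_transGen_swap.induction with
  | _ v ih =>
    intro x x' hx hx'
    by_contra hne
    have hvC : v ∉ C := by
      intro hvC
      cases hx with
      | step h => exact h hvC
      | here _ =>
        cases hx' with
        | step h => exact h hvC
        | here _ => exact hne rfl
    obtain ⟨a, ha, hmin⟩ := hacy.wellFounded_transGen.has_min {a | FirstHit E C v a} ⟨x, hx⟩
    obtain ⟨b, hb, hba⟩ : ∃ b, FirstHit E C v b ∧ b ≠ a := by
      by_cases h : x = a
      · exact ⟨x', hx', fun h' => hne (h.trans h'.symm)⟩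
      · exact ⟨x, hx, h⟩
    refine hvC (hC a (mem ha) b (mem hb)
      ⟨mem_SCA_iff.2 ⟨avoidReach ha (mem hb) hba, avoidReach hb (mem ha) hba.symm⟩, ?_⟩)
    intro w hw hwv hvw
    obtain ⟨⟨hwb, hwa⟩, hwa', hwb'⟩ := mem_SCA_iff.1 hw
    rcases Relation.ReflTransGen.cases_head hvw with h | ⟨c, hvc, hcw⟩
    · exact hwv h.symm
    have haw : ¬ Relation.ReflTransGen E a w := fun h => hwa' (hacy.antisymm h hwa.reach).symm
    obtain ⟨z, hz⟩ := exists_of_reach (hcw.trans hwa.reach) (mem ha)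
    have hza : z = a := by
      have hreach : Relation.ReflTransGen E z a := by
        by_cases hcz : c = z
        · exact hcz ▸ hcw.trans hwa.reach
        · rcases reflTransGen_avoid_or_through z (hcw.trans hwa.reach) with h | h
          · exact absurd (mem ha) (notMem_of_avoidReach
              (fun x' hx' => ih c (.single hvc) x' z hx' hz) h hcz)
          · exact h.2
      rcases Relation.reflTransGen_iff_eq_or_transGen.1 hreach with h | h
      · exact h.symm
      · exact absurd h (hmin z (FirstHit.step hvC hvc hz))
    subst hza
    have hcz : c ≠ z := fun h => haw (h ▸ hcw)
    rcases reflTransGen_avoid_or_through z hcw with h | h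
    · exact notMem_of_avoidReach (fun x' hx' => ih c (.single hvc) x' z hx' hz)
        (Relation.ReflTransGen.trans h hwb') hcz (mem hb)
    · exact haw h.2

end FirstHit

/-- Let `G = (V, E)` be a finite DAG and `Y ∈ V` a node with
at least one parent.  Then the LSCA closure `L∞(Pa(Y))` of the parents of `Y`
is the minimal globally interventionally superior set of `G` relative to `Y`:
it is a GISS relative to `Y`, and every GISS of `G` relative to `Y` that is
minimal with respect to set inclusion equals `L∞(Pa(Y))`. -/
theorem lscaClosure_parents_is_mgiss {V : Type} [Fintype V] (E : V → V → Prop)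
    (hacy : Acyclic E) (Y : V) (hpa : (Pa E Y).Nonempty) :
    IsGISS E Y (lscaClosure E (Pa E Y)) ∧
    ∀ U : Set V, IsGISS E Y U → (∀ U' : Set V, IsGISS E Y U' → U' ⊆ U → U' = U) →
      U = lscaClosure E (Pa E Y) := by
  have hgiss : IsGISS E Y (lscaClosure E (Pa E Y)) := by
    refine ⟨fun v hv => ⟨trivial, ?_⟩, ?_⟩
    · rintro rfl
      obtain ⟨k, hk⟩ := Set.mem_iUnion.1 hv
      exact hacy v (transGen_of_mem_lscaIter k v hk)
    · rintro W ⟨⟨-, hWY⟩, hWC⟩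
      have hP := subset_lscaClosure E (Pa E Y)
      have huniq := FirstHit.unique hacy (C := lscaClosure E (Pa E Y))
        (fun u hu u' hu' v hv => mem_lscaClosure_of_mem_LSCApair hu hu' hv) W
      by_cases h : ∃ X, FirstHit E (lscaClosure E (Pa E Y)) W X
      · obtain ⟨X, hX⟩ := h
        refine ⟨X, hX.mem, superior_of_not_avoidReach hacy fun hr => ?_⟩
        obtain ⟨X', hne, hX'⟩ := FirstHit.exists_ne_of_avoidReach hP hr hWY
          fun h => hWC (h ▸ hX.mem)
        exact hne (huniq X' X hX' hX)
      · obtain ⟨X, hX⟩ := hpa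
        refine ⟨X, hP hX, superior_of_not_avoidReach hacy fun hr => ?_⟩
        obtain ⟨X', -, hX'⟩ := FirstHit.exists_ne_of_avoidReach hP hr hWY
          fun h => hWC (h ▸ hP hX)
        exact h ⟨X', hX'⟩
  refine ⟨hgiss, fun U hU hmin => (hmin _ hgiss fun v hv => ?_).symm⟩
  by_contra hvU
  obtain ⟨k, hk⟩ := Set.mem_iUnion.1 hv
  obtain ⟨X, hX, hsup⟩ := hU.2 v ⟨hgiss.1 hv, hvU⟩
  have hne : v ≠ X := fun h => hvU (h ▸ hX)
  exact not_superior_of_avoidReach hacy hne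
    (avoidReach_of_mem_lscaIter k v hk X hne.symm (hU.1 hX).2) hsup
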